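/- arXiv:2605.20109 — 3 statements merged into one kernel-verified Lean document; each statement's English description precedes it below -/
import Mathlib

section
/- Let K = F_{q^{2m}} with (q,n) ≠ (2,2), and let C ⊆ K^n be a k-dimensional K-linear code with Hermitian hull dimension h ≥ 1; if q = 2 assume additionally that H(C) ≠ K·(1,…,1). Then there exists M ∈ GL_n(F_q) such that the equivalent code C·M has Hermitian hull dimension exactly h − 1. -/
open Matrix

/-- Hermitian (σ-twisted) dual of a code `C ⊆ K^n`, where σ = (x ↦ x^e). -/
noncomputable def hermDual {K : Type*} [Field K] (n e : ℕ) (C : Submodule K (Fin n → K)) :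
    Submodule K (Fin n → K) :=
  ⨅ c ∈ C, LinearMap.ker (∑ i : Fin n, (c i ^ e) • (LinearMap.proj i : (Fin n → K) →ₗ[K] K))

theorem mem_hermDual_iff {K : Type*} [Field K] (n e : ℕ) (C : Submodule K (Fin n → K))
    (s : K →+* K) (hs : ∀ x, s x = x ^ e) (x : Fin n → K) :
    x ∈ hermDual n e C ↔ ∀ c ∈ C, x ⬝ᵥ (fun i => s (c i)) = 0 := by
  simp only [hermDual, Submodule.mem_iInf, LinearMap.mem_ker, LinearMap.sum_apply,
    LinearMap.smul_apply, LinearMap.proj_apply, smul_eq_mul, dotProduct, hs]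
  simp only [mul_comm]

theorem gram_update {F K : Type*} [Field F] [Field K] [Algebra F K] (n : ℕ) (s : K →+* K)
    (hsF : ∀ a : F, s (algebraMap F K a) = algebraMap F K a)
    (M : Matrix (Fin n) (Fin n) F) (v : Fin n → F) (a : F)
    (hM : M * Mᵀ = 1 + a • vecMulVec v v) (z c : Fin n → K) :
    (z ᵥ* M.map (algebraMap F K)) ⬝ᵥ (fun i => s ((c ᵥ* M.map (algebraMap F K)) i)) =
      z ⬝ᵥ (fun i => s (c i)) + algebraMap F K a * (z ⬝ᵥ (fun i => algebraMap F K (v i))) *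
        s (c ⬝ᵥ (fun i => algebraMap F K (v i))) := by
  have e1 : (fun i => s ((c ᵥ* M.map (algebraMap F K)) i)) =
      (M.map (algebraMap F K))ᵀ *ᵥ (fun i => s (c i)) := by
    funext i
    simp only [vecMul, mulVec, dotProduct, map_sum, map_mul, map_apply, hsF, transpose_apply]
    simp only [mul_comm]
  have e2 : (M.map (algebraMap F K)) * (M.map (algebraMap F K))ᵀ =
      1 + algebraMap F K a • vecMulVec (fun i => algebraMap F K (v i))
        (fun i => algebraMap F K (v i)) := by
    have := congrArg (fun N => N.map (algebraMap F K)) hM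
    simp only [Matrix.map_mul] at this
    rw [transpose_map] at this
    rw [this]
    ext i j
    by_cases h : i = j <;> simp [h, vecMulVec_apply, Algebra.smul_def (A := K)]
  have e3 : s (c ⬝ᵥ (fun i => algebraMap F K (v i))) =
      (fun i => algebraMap F K (v i)) ⬝ᵥ (fun i => s (c i)) := by
    simp only [dotProduct, map_sum, map_mul, hsF]
    simp only [mul_comm]
  rw [e1, dotProduct_mulVec, vecMul_vecMul, e2, vecMul_add, vecMul_one, add_dotProduct,
    vecMul_smul, vecMul_vecMulVec, smul_dotProduct, smul_dotProduct, e3]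
  simp [mul_assoc]

theorem vecMul_inj_of_unit {F K : Type*} [Field F] [Field K] [Algebra F K] (n : ℕ)
    (M : Matrix (Fin n) (Fin n) F) (hu : IsUnit M) :
    Function.Injective (M.map (algebraMap F K)).vecMulLinear := by
  have : IsUnit (M.map (algebraMap F K)) := hu.map (algebraMap F K).mapMatrix
  exact Matrix.vecMul_injective_of_isUnit this

theorem finrank_inf_ker {K V : Type*} [Field K] [AddCommGroup V] [Module K V]
    [FiniteDimensional K V] (R : Submodule K V) (f : V →ₗ[K] K) (r : V) (hr : r ∈ R)
    (hf : f r ≠ 0) : Module.finrank K ↥(R ⊓ LinearMap.ker f) = Module.finrank K R - 1 := by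
  have h1 := LinearMap.finrank_range_add_finrank_ker (f.domRestrict R)
  have h2 : LinearMap.range (f.domRestrict R) = ⊤ := by
    apply LinearMap.range_eq_top.2
    apply LinearMap.surjective
    intro h
    exact hf (by simpa using congrArg (fun g => g ⟨r, hr⟩) h)
  have h3 : (R ⊓ LinearMap.ker f) = (LinearMap.ker (f.domRestrict R)).map R.subtype := by
    ext x
    simp [and_comm]
  rw [h3, Submodule.finrank_map_subtype_eq]
  rw [h2, finrank_top, Module.finrank_self] at h1
  omega

theorem herm_symm {K : Type*} [Field K] (n : ℕ) (s : K →+* K) (hss : ∀ x, s (s x) = x)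
    (x y : Fin n → K) (h : x ⬝ᵥ (fun i => s (y i)) = 0) : y ⬝ᵥ (fun i => s (x i)) = 0 := by
  have := congrArg s h
  simp only [dotProduct, map_sum, map_mul, hss, map_zero] at this
  rw [← this]
  simp only [dotProduct, mul_comm]

theorem hull_update {F K : Type*} [Field F] [Field K] [Algebra F K] (n e : ℕ) (s : K →+* K)
    (hs : ∀ x, s x = x ^ e) (hss : ∀ x, s (s x) = x)
    (hsF : ∀ a : F, s (algebraMap F K a) = algebraMap F K a)
    (C : Submodule K (Fin n → K))
    (M : Matrix (Fin n) (Fin n) F) (hu : IsUnit M) (v : Fin n → F) (a : F) (ha : a ≠ 0)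
    (hM : M * Mᵀ = 1 + a • vecMulVec v v) (r : Fin n → K) (hr : r ∈ C ⊓ hermDual n e C)
    (hrv : r ⬝ᵥ (fun i => algebraMap F K (v i)) ≠ 0) :
    Module.finrank K
        ↥((C.map (M.map (algebraMap F K)).vecMulLinear) ⊓
          hermDual n e (C.map (M.map (algebraMap F K)).vecMulLinear)) =
      Module.finrank K ↥(C ⊓ hermDual n e C) - 1 := by
  let f : (Fin n → K) →ₗ[K] K :=
    { toFun := fun x => x ⬝ᵥ (fun i => algebraMap F K (v i))
      map_add' := fun x y => add_dotProduct x y _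
      map_smul' := fun c x => smul_dotProduct c x _ }
  rw [← finrank_inf_ker (C ⊓ hermDual n e C) f r hr hrv]
  have hinj := vecMul_inj_of_unit (K := K) n M hu
  have : (C.map (M.map (algebraMap F K)).vecMulLinear) ⊓
          hermDual n e (C.map (M.map (algebraMap F K)).vecMulLinear) =
      ((C ⊓ hermDual n e C) ⊓ LinearMap.ker f).map (M.map (algebraMap F K)).vecMulLinear := by
    ext x
    simp only [Submodule.mem_inf, Submodule.mem_map, mem_hermDual_iff n e _ s hs,
      LinearMap.mem_ker]
    constructor
    · rintro ⟨⟨z, hz, rfl⟩, hx⟩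
      have hx' : ∀ c ∈ C, z ⬝ᵥ (fun i => s (c i)) + algebraMap F K a *
          (z ⬝ᵥ (fun i => algebraMap F K (v i))) *
          s (c ⬝ᵥ (fun i => algebraMap F K (v i))) = 0 := by
        intro c hc
        rw [← gram_update n s hsF M v a hM]
        exact hx _ ⟨c, hc, rfl⟩
      have hzr : z ⬝ᵥ (fun i => s (r i)) = 0 :=
        herm_symm n s hss _ _ ((mem_hermDual_iff n e C s hs r).1 hr.2 z hz)
      have hzv : z ⬝ᵥ (fun i => algebraMap F K (v i)) = 0 := by
        have := hx' r hr.1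
        rw [hzr, zero_add] at this
        simpa [ha, hrv] using this
      refine ⟨z, ⟨⟨hz, fun c hc => ?_⟩, hzv⟩, rfl⟩
      have := hx' c hc
      rw [hzv] at this
      simpa using this
    · rintro ⟨z, ⟨⟨hz, hz2⟩, hzv⟩, rfl⟩
      refine ⟨⟨z, hz, rfl⟩, ?_⟩
      rintro _ ⟨c, hc, rfl⟩
      have hzv' : z ⬝ᵥ (fun i => algebraMap F K (v i)) = 0 := hzv
      have := gram_update n s hsF M v a hM z c
      rw [hzv', hz2 c hc] at this
      simpa using this
  rw [this]
  exact (Submodule.equivMapOfInjective _ hinj _).finrank_eq.symm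

theorem char_two_matrix {F : Type*} [Field F] (n : ℕ) (h2 : (2 : F) = 0) (w e : Fin n → F)
    (hww : w ⬝ᵥ w = 0) (hwe : w ⬝ᵥ e = 0) (hee : e ⬝ᵥ e = 1) :
    ∃ M : Matrix (Fin n) (Fin n) F, IsUnit M ∧ M * Mᵀ = 1 + (1 : F) • vecMulVec w w := by
  have hew : e ⬝ᵥ w = 0 := by rw [dotProduct_comm, hwe]
  have dbl : ∀ A : Matrix (Fin n) (Fin n) F, A + A = 0 := by
    intro A
    rw [← two_smul F, h2, zero_smul]
  have hT : (1 + vecMulVec w w + vecMulVec w e + vecMulVec e w)ᵀ =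
      1 + vecMulVec w w + vecMulVec w e + vecMulVec e w := by
    simp only [transpose_add, transpose_one, transpose_vecMulVec]
    abel
  have hMM : (1 + vecMulVec w w + vecMulVec w e + vecMulVec e w) *
      (1 + vecMulVec w w + vecMulVec w e + vecMulVec e w) = 1 + vecMulVec w w := by
    simp only [mul_add, add_mul, vecMulVec_mul_vecMulVec, hww, hwe, hew, hee, zero_smul,
      vecMulVec_zero, one_smul, mul_one, one_mul, add_zero, zero_add]
    have h1 := dbl (vecMulVec w w)
    have h2 := dbl (vecMulVec w e)
    have h3 := dbl (vecMulVec e w)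
    calc _ = 1 + vecMulVec w w + (vecMulVec w w + vecMulVec w w)
          + (vecMulVec w e + vecMulVec w e) + (vecMulVec e w + vecMulVec e w) := by abel
      _ = _ := by rw [h1, h2, h3]; simp
  have hsq : (1 + vecMulVec w w) * (1 + vecMulVec w w) = 1 := by
    simp only [mul_add, add_mul, vecMulVec_mul_vecMulVec, hww, zero_smul,
      vecMulVec_zero, mul_one, one_mul, add_zero, add_assoc, dbl]
  refine ⟨1 + vecMulVec w w + vecMulVec w e + vecMulVec e w, ?_, ?_⟩
  · rw [← hMM] at hsq
    rw [mul_assoc] at hsq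
    exact IsUnit.of_mul_eq_one _ hsq
  · rw [hT, hMM, one_smul]

theorem isotropic_matrix {F : Type*} [Field F] (n : ℕ) (v : Fin n → F) (hv : v ⬝ᵥ v = 0) :
    ∃ M : Matrix (Fin n) (Fin n) F, IsUnit M ∧ M * Mᵀ = 1 + (2 : F) • vecMulVec v v := by
  refine ⟨1 + vecMulVec v v, ?_, ?_⟩
  · apply IsUnit.of_mul_eq_one (1 - vecMulVec v v)
    simp [mul_sub, add_mul, vecMulVec_mul_vecMulVec, hv]
  · simp [mul_add, add_mul, vecMulVec_mul_vecMulVec, hv, two_smul, add_assoc]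

theorem dim_two_case {F K : Type*} [Field F] [Field K] [Algebra F K] (e : ℕ) (s : K →+* K)
    (hs : ∀ x, s x = x ^ e) (hss : ∀ x, s (s x) = x)
    (hsF : ∀ a : F, s (algebraMap F K a) = algebraMap F K a) (h3 : (3 : F) = 0)
    (C : Submodule K (Fin 2 → K)) (r : Fin 2 → K) (hr0 : r ≠ 0)
    (hrC : r ∈ C) (hr : ∀ c ∈ C, r ⬝ᵥ (fun i => s (c i)) = 0) :
    Module.finrank K ↥(C ⊓ hermDual 2 e C) = 1 ∧
    ∃ M : Matrix (Fin 2) (Fin 2) F, IsUnit M ∧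
      Module.finrank K
        ↥((C.map (M.map (algebraMap F K)).vecMulLinear) ⊓
          hermDual 2 e (C.map (M.map (algebraMap F K)).vecMulLinear)) = 0 := by
  have h3K : (3 : K) = 0 := by
    have := congrArg (algebraMap F K) h3
    rwa [map_ofNat, map_zero] at this
  have hrr : r 0 * s (r 0) + r 1 * s (r 1) = 0 := by
    simpa [dotProduct, Fin.sum_univ_two] using hr r hrC
  have hr00 : r 0 ≠ 0 := by
    intro h
    apply hr0
    rw [h] at hrr
    have : r 1 = 0 := by simpa using hrr
    funext i
    fin_cases i <;> simp [h, this]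
  have hr1 : r 1 ≠ 0 := by
    intro h
    rw [h] at hrr
    simp [hr00] at hrr
  have hs1 : s (r 1) ≠ 0 := by simpa using hr1
  have hC : C = Submodule.span K {r} := by
    apply le_antisymm
    · intro x hx
      rw [Submodule.mem_span_singleton]
      have h4 := herm_symm 2 s hss _ _ (hr x hx)
      have h5 : x 0 * s (r 0) + x 1 * s (r 1) = 0 := by
        simpa [dotProduct, Fin.sum_univ_two] using h4
      refine ⟨x 0 / r 0, ?_⟩
      funext i
      fin_cases i
      · simp [hr00]
      · simp only [Fin.mk_one, Pi.smul_apply, smul_eq_mul]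
        field_simp
        apply mul_right_cancel₀ hs1
        linear_combination x 0 * hrr - r 0 * h5
    · simpa using hrC
  constructor
  · have : C ⊓ hermDual 2 e C = C := by
      apply inf_eq_left.2
      intro x hx
      rw [mem_hermDual_iff 2 e C s hs]
      intro c hc
      rw [hC, Submodule.mem_span_singleton] at hx
      obtain ⟨a, rfl⟩ := hx
      rw [smul_dotProduct, hr c hc, smul_zero]
    rw [this, hC, finrank_span_singleton hr0]
  · have main : ∀ t : F, r 0 * s (r 0) + (algebraMap F K t * r 0 + r 1) *
        s (algebraMap F K t * r 0 + r 1) ≠ 0 → ∃ M : Matrix (Fin 2) (Fin 2) F, IsUnit M ∧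
        Module.finrank K
        ↥((C.map (M.map (algebraMap F K)).vecMulLinear) ⊓
          hermDual 2 e (C.map (M.map (algebraMap F K)).vecMulLinear)) = 0 := by
      intro t ht
      refine ⟨!![1, t; 0, 1], ?_, ?_⟩
      · rw [Matrix.isUnit_iff_isUnit_det]
        simp [Matrix.det_fin_two]
      · rw [Submodule.finrank_eq_zero, eq_bot_iff]
        rintro x ⟨⟨z, hz, rfl⟩, hx⟩
        have hx2 := (mem_hermDual_iff 2 e _ s hs _).1 hx _ ⟨r, hrC, rfl⟩
        rw [SetLike.mem_coe, hC, Submodule.mem_span_singleton] at hz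
        obtain ⟨a, rfl⟩ := hz
        rw [map_smul, smul_dotProduct, smul_eq_mul] at hx2
        have hne : ((!![1, t; 0, 1].map (algebraMap F K)).vecMulLinear r ⬝ᵥ
            fun i => s ((!![1, t; 0, 1].map (algebraMap F K)).vecMulLinear r i)) ≠ 0 := by
          convert ht using 1
          simp [dotProduct, Fin.sum_univ_two, vecMul]
          ring
        have ha := (mul_eq_zero.1 hx2).resolve_right hne
        simp [ha]
    by_cases hp : r 0 * s (r 0) + (algebraMap F K 1 * r 0 + r 1) *
        s (algebraMap F K 1 * r 0 + r 1) = 0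
    · apply main (-1)
      intro hm
      have hs0 : s (r 0) ≠ 0 := by simpa using hr00
      simp only [map_neg, map_one, map_add, map_mul] at hp hm
      apply mul_ne_zero hr00 hs0
      linear_combination 2 * hrr - hp - hm + r 0 * s (r 0) * h3K
    · exact main 1 hp

theorem stmt7 (m n h : ℕ) (hm : 1 ≤ m)
    (F : Type*) [Field F] [Fintype F]
    (K : Type*) [Field K] [Fintype K] [Algebra F K]
    (hK : Fintype.card K = Fintype.card F ^ (2 * m))
    (hqn : ¬(Fintype.card F = 2 ∧ n = 2))
    (C : Submodule K (Fin n → K))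
    (hh : Module.finrank K ↥(C ⊓ hermDual n (Fintype.card F ^ m) C) = h) (h1 : 1 ≤ h)
    (hones : Fintype.card F = 2 →
      C ⊓ hermDual n (Fintype.card F ^ m) C ≠ Submodule.span K {(fun _ => 1 : Fin n → K)}) :
    ∃ M : Matrix (Fin n) (Fin n) F, IsUnit M ∧
      Module.finrank K
        ↥((C.map (M.map (algebraMap F K)).vecMulLinear) ⊓
          hermDual n (Fintype.card F ^ m) (C.map (M.map (algebraMap F K)).vecMulLinear)) = h - 1 := by
  obtain ⟨s, hs⟩ : ∃ s : K →+* K, ∀ x, s x = x ^ (Fintype.card F ^ m) := by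
    refine ⟨((FiniteField.frobeniusAlgHom F K) ^ m : K →ₐ[F] K).toRingHom, fun x => ?_⟩
    simp [FiniteField.coe_frobeniusAlgHom, AlgHom.coe_pow, pow_iterate]
  have hss : ∀ x, s (s x) = x := by
    intro x
    rw [hs, hs, ← pow_mul, ← pow_add, ← two_mul, ← hK, FiniteField.pow_card]
  have hsF : ∀ a : F, s (algebraMap F K a) = algebraMap F K a := by
    intro a
    rw [hs, ← map_pow, FiniteField.pow_card_pow]
  have key := hull_update (F := F) n _ s hs hss hsF C
  rw [hh] at key
  generalize hR : C ⊓ hermDual n (Fintype.card F ^ m) C = R at *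
  have hRbot : R ≠ ⊥ := by
    rintro rfl
    simp at hh
    omega
  obtain ⟨r, hr, hr0⟩ := Submodule.exists_mem_ne_zero_of_ne_bot hRbot
  obtain ⟨i, hi⟩ := Function.ne_iff.1 hr0
  simp only [Pi.zero_apply] at hi
  have hiso : ∀ x ∈ R, ∀ c ∈ C, x ⬝ᵥ (fun i => s (c i)) = 0 := by
    intro x hx
    rw [← hR] at hx
    exact (mem_hermDual_iff n _ C s hs x).1 hx.2
  have hRC : ∀ x ∈ R, x ∈ C := by
    intro x hx
    rw [← hR] at hx
    exact hx.1
  have hn1 : n ≠ 1 := by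
    rintro rfl
    have := hiso r hr r (hRC r hr)
    rw [Subsingleton.elim i 0] at hi
    simp [dotProduct, hi] at this
  have hq1 : 1 < Fintype.card F := Fintype.one_lt_card
  have hipos := i.pos
  rcases Nat.lt_or_ge 3 (Fintype.card F) with hq | hq
  · -- q ≥ 4
    classical
    obtain ⟨c, hc⟩ : ∃ c : F, c ∉ ({0, 1, -1} : Finset F) := by
      by_contra hcon
      push Not at hcon
      have h2 := Finset.card_le_card (fun x _ => hcon x : (Finset.univ : Finset F) ⊆ {0, 1, -1})
      have h3 := Finset.card_le_three (a := (0 : F)) (b := 1) (c := -1)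
      rw [Finset.card_univ] at h2
      omega
    simp only [Finset.mem_insert, Finset.mem_singleton, not_or] at hc
    obtain ⟨hc0, hc1, hc2⟩ := hc
    have ha : c ^ 2 - 1 ≠ 0 := by
      intro h0
      rcases sq_eq_one_iff.1 (sub_eq_zero.1 h0) with h | h <;> contradiction
    have hu : IsUnit (Matrix.diagonal (Function.update (1 : Fin n → F) i c)) := by
      rw [Matrix.isUnit_diagonal, Pi.isUnit_iff]
      intro j
      by_cases hj : j = i
      · subst hj; simpa using hc0
      · simp [hj]
    refine ⟨_, hu, key _ hu (Pi.single i 1) (c ^ 2 - 1) ha ?_ r hr ?_⟩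
    · rw [diagonal_transpose, diagonal_mul_diagonal]
      ext j k
      by_cases hj : j = i
      · subst hj
        by_cases hk : j = k
        · subst hk
          simp [vecMulVec_apply]
          ring
        · simp [vecMulVec_apply, hk, Ne.symm hk]
      · by_cases hk : j = k
        · subst hk
          simp [vecMulVec_apply, hj]
        · simp [vecMulVec_apply, hk, hj]
    · have : (fun j => algebraMap F K ((Pi.single i 1 : Fin n → F) j)) = Pi.single i 1 := by
        funext j
        by_cases hj : j = i
        · subst hj; simp
        · simp [hj]
      rw [this]
      simpa using hi
  · have hq' : Fintype.card F = 2 ∨ Fintype.card F = 3 := by omega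
    rcases hq' with hq2 | hq3
    · have hn3 : 2 < n := by
        have : n ≠ 2 := fun h => hqn ⟨hq2, h⟩
        omega
      have h2 : (2 : F) = 0 := by
        have := Nat.cast_card_eq_zero F
        rw [hq2] at this
        exact_mod_cast this
      have h2K : (2 : K) = 0 := by
        have := congrArg (algebraMap F K) h2
        rwa [map_ofNat, map_zero] at this
      obtain ⟨x, hx, j, k, hjk⟩ : ∃ x ∈ R, ∃ j k, x j ≠ x k := by
        by_contra hcon
        push Not at hcon
        apply hones hq2
        apply le_antisymm
        · intro x hx
          rw [Submodule.mem_span_singleton]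
          refine ⟨x i, ?_⟩
          funext l
          simp [hcon x hx l i]
        · rw [Submodule.span_singleton_le_iff_mem]
          have := R.smul_mem (r i)⁻¹ hr
          convert this using 1
          funext l
          simp [hcon r hr l i, hi]
      have hjk' : j ≠ k := fun h => hjk (by rw [h])
      obtain ⟨l, hlj, hlk⟩ := Fin.exists_ne_and_ne_of_two_lt j k hn3
      obtain ⟨M, hu, hM⟩ := char_two_matrix n h2 (Pi.single j 1 + Pi.single k 1)
        (Pi.single l 1) (by simp [hjk', hjk'.symm, one_add_one_eq_two, h2])
        (by simp [hlj, hlk, hlj.symm, hlk.symm]) (by simp)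
      refine ⟨M, hu, key M hu _ 1 one_ne_zero hM x hx ?_⟩
      have : (fun i => algebraMap F K ((Pi.single j 1 + Pi.single k 1 : Fin n → F) i)) =
          Pi.single j 1 + Pi.single k 1 := by
        funext i
        simp [Pi.single_apply, apply_ite (algebraMap F K)]
      rw [this]
      simp only [dotProduct_add, dotProduct_single, mul_one]
      intro h0
      apply hjk
      linear_combination h0 - x k * h2K
    · have h3 : (3 : F) = 0 := by
        have := Nat.cast_card_eq_zero F
        rw [hq3] at this
        exact_mod_cast this
      have h2 : (2 : F) ≠ 0 := by
        intro h2
        exact one_ne_zero (α := F) (by linear_combination h3 - h2)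
      by_cases hn2 : n = 2
      · subst hn2
        obtain ⟨hd, M, hu, hM⟩ := dim_two_case _ s hs hss hsF h3 C r hr0 (hRC r hr) (hiso r hr)
        rw [hR, hh] at hd
        exact ⟨M, hu, by rw [hM, hd]⟩
      · have hn3 : 2 < n := by omega
        obtain ⟨j, hji, -⟩ := Fin.exists_ne_and_ne_of_two_lt i i hn3
        obtain ⟨k, hki, hkj⟩ := Fin.exists_ne_and_ne_of_two_lt i j hn3
        have main : ∀ t : F, t * t = 1 →
            r i + algebraMap F K t * (r j + r k) ≠ 0 →
            ∃ M : Matrix (Fin n) (Fin n) F, IsUnit M ∧ Module.finrank K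
              ↥((C.map (M.map (algebraMap F K)).vecMulLinear) ⊓
                hermDual n (Fintype.card F ^ m)
                  (C.map (M.map (algebraMap F K)).vecMulLinear)) = h - 1 := by
          intro t ht htr
          obtain ⟨M, hu, hM⟩ := isotropic_matrix n
            (Pi.single i 1 + Pi.single j t + Pi.single k t : Fin n → F) (by
              simp [hji, hki, hkj, hji.symm, hki.symm, hkj.symm]
              linear_combination 2 * ht + h3)
          refine ⟨M, hu, key M hu _ 2 h2 hM r hr ?_⟩
          have : (fun l => algebraMap F K
              ((Pi.single i 1 + Pi.single j t + Pi.single k t : Fin n → F) l)) =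
              Pi.single i 1 + Pi.single j (algebraMap F K t) +
                Pi.single k (algebraMap F K t) := by
            funext l
            simp [Pi.single_apply, apply_ite (algebraMap F K)]
          rw [this]
          simp only [dotProduct_add, dotProduct_single, mul_one]
          convert htr using 1
          ring
        by_cases hp : r i + algebraMap F K 1 * (r j + r k) = 0
        · apply main (-1) (by ring)
          intro hm
          have h2K : (2 : K) ≠ 0 := by
            have := (map_ne_zero (algebraMap F K)).2 h2
            rwa [map_ofNat] at this
          apply mul_ne_zero h2K hi
          simp only [map_neg, map_one] at hp hm
          linear_combination hp + hm
        · exact main 1 (by ring) hp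
end

section
/- Let K = F_{q^{2m}} with (q,n) ≠ (2,2), and let C ⊆ K^n be a k-dimensional K-linear code with Hermitian hull dimension h. Then for every ℓ ∈ {0,1,…,h} there exists M ∈ GL_n(F_q) such that C·M has Hermitian hull dimension exactly ℓ. In particular, C is equivalent to a Hermitian LCD code (one with trivial Hermitian hull). -/
open Matrix

theorem mem_hermDual {K : Type*} [Field K] (n e : ℕ) (C : Submodule K (Fin n → K)) (x : Fin n → K) :
    x ∈ hermDual n e C ↔ ∀ c ∈ C, ∑ i, c i ^ e * x i = 0 := by
  simp [hermDual, Submodule.mem_iInf]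

section
variable {F K : Type*} [Field F] [Field K] [Algebra F K]

/-- the sesquilinear form -/
def sB {n : ℕ} (σ : K →ₐ[F] K) (x y : Fin n → K) : K := x ⬝ᵥ (fun i => σ (y i))

/-- the hull -/
noncomputable def hull (n e : ℕ) (C : Submodule K (Fin n → K)) : Submodule K (Fin n → K) :=
  C ⊓ hermDual n e C

theorem mem_hull {n e : ℕ} (σ : K →ₐ[F] K) (hσ : ∀ x, σ x = x ^ e) (C : Submodule K (Fin n → K))
    (x : Fin n → K) : x ∈ hull n e C ↔ x ∈ C ∧ ∀ c ∈ C, sB σ x c = 0 := by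
  simp [hull, mem_hermDual, sB, dotProduct, hσ, mul_comm]

theorem sB_symm {n : ℕ} (σ : K →ₐ[F] K) (hσ2 : ∀ x, σ (σ x) = x) (x y : Fin n → K) :
    σ (sB σ x y) = sB σ y x := by
  simp [sB, dotProduct, hσ2, mul_comm]

/-- right multiplication by `M` -/
noncomputable def rm {n : ℕ} (M : Matrix (Fin n) (Fin n) F) : (Fin n → K) →ₗ[K] (Fin n → K) :=
  (M.map (algebraMap F K)).vecMulLinear

theorem rm_injective {n : ℕ} (M : Matrix (Fin n) (Fin n) F) (hM : IsUnit M) :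
    Function.Injective (rm (K := K) M) := by
  have h : IsUnit (M.map (algebraMap F K)) := by
    simpa using hM.map (algebraMap F K).mapMatrix
  exact Matrix.vecMul_injective_of_isUnit h

theorem rm_mul {n : ℕ} (M N : Matrix (Fin n) (Fin n) F) (C : Submodule K (Fin n → K)) :
    (C.map (rm M)).map (rm N) = C.map (rm (M * N)) := by
  rw [← Submodule.map_comp]
  congr 1
  refine LinearMap.ext fun x => ?_
  simp [rm, Matrix.map_mul]

theorem key {n e : ℕ} (σ : K →ₐ[F] K) (hσ : ∀ x, σ x = x ^ e) (hσ2 : ∀ x, σ (σ x) = x)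
    (C : Submodule K (Fin n → K)) (M : Matrix (Fin n) (Fin n) F) (hM : IsUnit M)
    (φ : (Fin n → K) →ₗ[K] K) (lam : K) (hlam : lam ≠ 0)
    (hB : ∀ x ∈ C, ∀ y ∈ C, sB σ (rm M x) (rm M y) = sB σ x y + lam * φ x * σ (φ y))
    (r : Fin n → K) (hr : r ∈ hull n e C) (hφ : φ r ≠ 0) :
    Module.finrank K (hull n e (C.map (rm M))) + 1 = Module.finrank K (hull n e C) := by
  have hinj := rm_injective (K := K) M hM
  have h1 : hull n e (C.map (rm M)) = (hull n e C ⊓ LinearMap.ker φ).map (rm M) := by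
    ext z
    rw [mem_hull σ hσ]
    simp only [Submodule.mem_map, Submodule.mem_inf, LinearMap.mem_ker, mem_hull σ hσ]
    constructor
    · rintro ⟨⟨x, hx, rfl⟩, h⟩
      have h' : ∀ y ∈ C, sB σ x y + lam * φ x * σ (φ y) = 0 := fun y hy => by
        rw [← hB x hx y hy]; exact h _ ⟨y, hy, rfl⟩
      have hr' := (mem_hull σ hσ C r).1 hr
      have h0 : φ x = 0 := by
        have := h' r hr'.1
        rw [← sB_symm σ hσ2, hr'.2 x hx] at this
        simpa [hlam, hφ] using this
      refine ⟨x, ⟨⟨hx, fun c hc => ?_⟩, h0⟩, rfl⟩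
      simpa [h0] using h' c hc
    · rintro ⟨x, ⟨⟨hx, h⟩, h0⟩, rfl⟩
      refine ⟨⟨x, hx, rfl⟩, ?_⟩
      rintro _ ⟨y, hy, rfl⟩
      rw [hB x hx y hy, h y hy, h0]; simp
  rw [h1, ← LinearEquiv.finrank_eq (Submodule.equivMapOfInjective _ hinj _)]
  have h2 := LinearMap.finrank_range_add_finrank_ker (φ.domRestrict (hull n e C))
  have h3 : LinearMap.range (φ.domRestrict (hull n e C)) = ⊤ := by
    apply LinearMap.range_eq_top.2
    apply LinearMap.surjective
    intro h
    exact hφ (by simpa using LinearMap.congr_fun h ⟨r, hr⟩)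
  have h4 : hull n e C ⊓ LinearMap.ker φ
      = (LinearMap.ker (φ.domRestrict (hull n e C))).map (hull n e C).subtype := by
    ext x
    simp [and_comm]
  rw [h3, finrank_top, Module.finrank_self] at h2
  rw [h4, ← LinearEquiv.finrank_eq (Submodule.equivMapOfInjective _ (Submodule.subtype_injective _) _)]
  omega

theorem sB_rm {n : ℕ} (σ : K →ₐ[F] K) (M : Matrix (Fin n) (Fin n) F) (x y : Fin n → K) :
    sB σ (rm M x) (rm M y) = x ⬝ᵥ (((M * Mᵀ).map (algebraMap F K)) *ᵥ (fun i => σ (y i))) := by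
  have h : (fun i => σ (rm M y i)) = (fun i => σ (y i)) ᵥ* (M.map (algebraMap F K)) := by
    ext i
    simp [rm, vecMul, dotProduct]
  rw [sB, h, Matrix.map_mul, ← mulVec_mulVec, dotProduct_mulVec]
  simp [rm, transpose_map, mulVec_transpose]

theorem key2 {n e : ℕ} (σ : K →ₐ[F] K) (hσ : ∀ x, σ x = x ^ e) (hσ2 : ∀ x, σ (σ x) = x)
    (C : Submodule K (Fin n → K)) (M : Matrix (Fin n) (Fin n) F) (hM : IsUnit M)
    (v : Fin n → F) (lam : F) (hlam : lam ≠ 0)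
    (hMM : M * Mᵀ = 1 + lam • vecMulVec v v)
    (r : Fin n → K) (hr : r ∈ hull n e C) (hφ : ∑ i, r i * algebraMap F K (v i) ≠ 0) :
    Module.finrank K (hull n e (C.map (rm M))) + 1 = Module.finrank K (hull n e C) := by
  refine key σ hσ hσ2 C M hM (∑ i, algebraMap F K (v i) • LinearMap.proj i) (algebraMap F K lam)
    (by simpa using hlam) ?_ r hr (by simpa [Algebra.smul_def, mul_comm] using hφ)
  intro x _ y _
  rw [sB_rm, hMM]
  have : (1 + lam • vecMulVec v v : Matrix (Fin n) (Fin n) F).map (algebraMap F K)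
     = 1 + algebraMap F K lam • vecMulVec (fun i => algebraMap F K (v i)) (fun i => algebraMap F K (v i)) := by
    ext i j
    by_cases h : i = j <;> simp [vecMulVec_apply, h] <;> rw [Algebra.smul_def]
  rw [this, add_mulVec, smul_mulVec, vecMulVec_mulVec, dotProduct_add, one_mulVec, sB]
  simp only [dotProduct, Pi.smul_apply, smul_eq_mul, MulOpposite.smul_eq_mul_unop,
    MulOpposite.unop_op, LinearMap.sum_apply, LinearMap.smul_apply, LinearMap.proj_apply, map_sum,
    map_mul, AlgHom.commutes, Finset.mul_sum, Finset.sum_mul]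
  congr 1
  rw [Finset.sum_comm]
  refine Finset.sum_congr rfl fun a _ => Finset.sum_congr rfl fun b _ => by ring

theorem rank1 {n : ℕ} (v : Fin n → F) (μ : F) (h : 1 + μ * (v ⬝ᵥ v) ≠ 0) :
    IsUnit (1 + μ • vecMulVec v v) ∧
    (1 + μ • vecMulVec v v) * (1 + μ • vecMulVec v v)ᵀ
      = 1 + (2 * μ + μ ^ 2 * (v ⬝ᵥ v)) • vecMulVec v v := by
  have h2 : vecMulVec v v * vecMulVec v v = (v ⬝ᵥ v) • vecMulVec v v := by
    rw [vecMulVec_mul_vecMulVec]; ext i j; simp [vecMulVec_apply]; ring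
  constructor
  · apply IsUnit.of_mul_eq_one (1 - (μ / (1 + μ * (v ⬝ᵥ v))) • vecMulVec v v)
    simp only [add_mul, mul_sub, one_mul, mul_one, smul_mul_assoc, mul_smul_comm, h2]
    ext i j
    simp
    field_simp
    ring
  · rw [transpose_add, transpose_smul, transpose_vecMulVec]
    simp only [add_mul, mul_add, one_mul, mul_one, smul_mul_assoc, mul_smul_comm, h2, transpose_one]
    ext i j
    simp
    ring

theorem mat3 {n : ℕ} (h2 : (2 : F) = 0) (i j k : Fin n) (hij : i ≠ j) (hik : i ≠ k) (hjk : j ≠ k) :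
   ∃ M : Matrix (Fin n) (Fin n) F, IsUnit M ∧
    M * Mᵀ = 1 + (1:F) • vecMulVec (Pi.single i 1 + Pi.single j 1) (Pi.single i 1 + Pi.single j 1) := by
  let S : Fin n → Fin n → Matrix (Fin n) (Fin n) F := fun a b => single a b 1
  have hv : vecMulVec (Pi.single i 1 + Pi.single j 1) (Pi.single i 1 + Pi.single j 1)
     = S i i + S i j + S j i + S j j := by
    simp only [S, single_eq_single_vecMulVec_single, vecMulVec_add, add_vecMulVec]
    abel
  have h22 : ∀ A : Matrix (Fin n) (Fin n) F, A + A = 0 := fun A => by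
    rw [← two_smul F, h2, zero_smul]
  have hM : (1 + (S i j + S j k + S k i + S k j)) * (1 + (S i j + S j k + S k i + S k j))ᵀ
     = 1 + (S i i + S i j + S j i + S j j) := by
    simp only [S, transpose_add, transpose_one, transpose_single, add_mul, mul_add, one_mul, mul_one,
      single_mul_single_same, single_mul_single_of_ne _ _ _ _ hij, single_mul_single_of_ne _ _ _ _ hij.symm,
      single_mul_single_of_ne _ _ _ _ hik, single_mul_single_of_ne _ _ _ _ hik.symm,
      single_mul_single_of_ne _ _ _ _ hjk, single_mul_single_of_ne _ _ _ _ hjk.symm]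
    ext a b
    simp only [Matrix.add_apply, Matrix.zero_apply]
    linear_combination (single i k (1:F) a b + single k i (1:F) a b + single k k (1:F) a b + single j k (1:F) a b + single k j (1:F) a b) * h2
  have hN : (1 + (S i i + S i j + S j i + S j j)) * (1 + (S i i + S i j + S j i + S j j)) = 1 := by
    simp only [S, add_mul, mul_add, one_mul, mul_one,
      single_mul_single_same, single_mul_single_of_ne _ _ _ _ hij, single_mul_single_of_ne _ _ _ _ hij.symm]
    ext a b
    simp only [Matrix.add_apply, Matrix.zero_apply]
    linear_combination (2 * single i i (1:F) a b + 2 * single j j (1:F) a b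
      + 2 * single i j (1:F) a b + 2 * single j i (1:F) a b) * h2
  refine ⟨1 + (S i j + S j k + S k i + S k j), ?_, ?_⟩
  · rw [← hM, mul_assoc] at hN
    exact IsUnit.of_mul_eq_one _ hN
  · rw [hv, one_smul, hM]


theorem puncture {n e : ℕ} (σ : K →ₐ[F] K) (hσ : ∀ x, σ x = x ^ e) (hσ2 : ∀ x, σ (σ x) = x)
    (h2 : (2 : F) = 0)
    (C : Submodule K (Fin n → K)) (i : Fin n)
    (hr : (fun _ => 1) ∈ hull n e C) :
    ∃ M : Matrix (Fin n) (Fin n) F, IsUnit M ∧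
    Module.finrank K (hull n e (C.map (rm M))) + 1 = Module.finrank K (hull n e C) := by
  have h2K : (2 : K) = 0 := by
    have := congrArg (algebraMap F K) h2
    rwa [map_ofNat, map_zero] at this
  let w : Fin n → F := fun j => if j = i then 0 else 1
  let u : Fin n → F := Pi.single i 1
  have huw : u ⬝ᵥ w = 0 := by simp [u, w]
  let M : Matrix (Fin n) (Fin n) F := 1 + vecMulVec w u
  have hM : IsUnit M := by
    apply IsUnit.of_mul_eq_one M
    simp only [M, add_mul, mul_add, one_mul, mul_one, vecMulVec_mul_vecMulVec, huw, zero_smul]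
    ext a b
    simp
    linear_combination (vecMulVec w u a b) * h2
  refine ⟨M, hM, key σ hσ hσ2 C M hM (LinearMap.proj i) (-1) (by simp) ?_ _ hr (by simp)⟩
  have hsum : ∀ x ∈ C, ∑ j, x j = 0 := by
    intro x hx
    have h := ((mem_hull σ hσ C _).1 hr).2 x hx
    rw [← map_eq_zero σ, sB_symm σ hσ2] at h
    simpa [sB, dotProduct] using h
  have hrm : ∀ x ∈ C, ∀ j, rm M x j = if j = i then 0 else x j := by
    intro x hx j
    have h1 : rm M x j = x j + (∑ a, x a * algebraMap F K (w a)) * algebraMap F K (u j) := by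
      have : M.map (algebraMap F K) = 1 + vecMulVec (fun a => algebraMap F K (w a))
          (fun a => algebraMap F K (u a)) := by
        ext a b
        by_cases h : a = b <;> simp [M, h, vecMulVec_apply]
      simp only [rm, this, vecMulLinear_apply, vecMul_add, vecMul_one, vecMul_vecMulVec]
      simp [dotProduct]
    have h3 : ∑ a, x a * algebraMap F K (w a) = - x i := by
      have h4 : ∑ a, x a * algebraMap F K (w a) + x i = ∑ a, x a := by
        have : x i = ∑ a, if a = i then x a else 0 := by simp
        conv_lhs => rw [this]
        rw [← Finset.sum_add_distrib]
        refine Finset.sum_congr rfl fun a _ => ?_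
        by_cases h : a = i <;> simp [w, h]
      rw [hsum x hx] at h4
      exact eq_neg_of_add_eq_zero_left h4
    rw [h1, h3]
    by_cases h : j = i
    · subst h; simp [u]
    · simp [u, h]
  intro x hx y hy
  have : x i * σ (y i) = ∑ a, if a = i then x a * σ (y a) else 0 := by simp
  simp only [sB, dotProduct, hrm x hx, hrm y hy, LinearMap.proj_apply]
  rw [neg_one_mul, neg_mul, this, ← Finset.sum_neg_distrib, ← Finset.sum_add_distrib]
  refine Finset.sum_congr rfl fun a _ => ?_
  by_cases h : a = i <;> simp [h]

theorem two3 {e : ℕ} (σ : K →ₐ[F] K) (hσ : ∀ x, σ x = x ^ e) (hσ2 : ∀ x, σ (σ x) = x)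
    (h3 : (3 : F) = 0)
    (C : Submodule K (Fin 2 → K)) (r : Fin 2 → K) (hr : r ∈ hull 2 e C) (hr0 : r ≠ 0) :
    ∃ M : Matrix (Fin 2) (Fin 2) F, IsUnit M ∧
    Module.finrank K (hull 2 e (C.map (rm M))) + 1 = Module.finrank K (hull 2 e C) := by
  have h3K : (3 : K) = 0 := by
    have := congrArg (algebraMap F K) h3
    rwa [map_ofNat, map_zero] at this
  have hr' := (mem_hull σ hσ C _).1 hr
  have hrr : r 0 * σ (r 0) + r 1 * σ (r 1) = 0 := by
    simpa [sB, dotProduct, Fin.sum_univ_two] using hr'.2 r hr'.1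
  have hb : r 1 ≠ 0 := by
    intro h
    apply hr0
    have : r 0 = 0 := by simpa [h] using hrr
    ext i; fin_cases i <;> simp [h, this]
  have ha : r 0 ≠ 0 := by
    intro h
    simp [h, hb] at hrr
  have hsb : σ (r 1) ≠ 0 := by simpa using hb
  have hsa : σ (r 0) ≠ 0 := by simpa using ha
  have hC : ∀ x ∈ C, x = (x 1 / r 1) • r := by
    intro x hx
    have h := hr'.2 x hx
    rw [← map_eq_zero σ, sB_symm σ hσ2] at h
    have h : x 0 * σ (r 0) + x 1 * σ (r 1) = 0 := by
      simpa [sB, dotProduct, Fin.sum_univ_two] using h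
    ext i
    fin_cases i
    · simp
      field_simp
      apply mul_right_cancel₀ hsa
      linear_combination r 1 * h - x 1 * hrr
    · simp [hb]
  -- general choice of the off-diagonal entry
  have main : ∀ b : F, sB σ (rm !![1, 0; b, 1] r) (rm !![1, 0; b, 1] r) ≠ 0 →
      ∃ M : Matrix (Fin 2) (Fin 2) F, IsUnit M ∧
      Module.finrank K (hull 2 e (C.map (rm M))) + 1 = Module.finrank K (hull 2 e C) := by
    intro b hb'
    have hM : IsUnit (!![1, 0; b, 1] : Matrix (Fin 2) (Fin 2) F) := by
      rw [Matrix.isUnit_iff_isUnit_det]; simp [Matrix.det_fin_two]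
    refine ⟨_, hM, key σ hσ hσ2 C _ hM (LinearMap.proj 1)
      (sB σ (rm !![1, 0; b, 1] r) (rm !![1, 0; b, 1] r) / (r 1 * σ (r 1)))
      (div_ne_zero hb' (mul_ne_zero hb hsb)) ?_ r hr hb⟩
    intro x hx y hy
    have hs : ∀ (s t : K) (x y : Fin 2 → K), sB σ (s • x) (t • y) = s * σ t * sB σ x y := by
      intro s t x y
      simp [sB, dotProduct, Fin.sum_univ_two]; ring
    have hrr' : sB σ r r = 0 := hr'.2 r hr'.1
    conv_lhs => rw [hC x hx, hC y hy]
    rw [map_smul, map_smul, hs]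
    have h0 : sB σ x y = 0 := by
      rw [hC x hx, hC y hy, hs, hrr', mul_zero]
    rw [h0]
    simp only [map_div₀, LinearMap.proj_apply]
    field_simp
    ring
  by_contra hcon
  have hA := not_imp_comm.1 (main 1) hcon
  have hB := not_imp_comm.1 (main (-1)) hcon
  simp [sB, rm, dotProduct, Fin.sum_univ_two, vecMul] at hA hB
  have : r 1 * σ (r 1) = 0 := by
    linear_combination 2 * hrr - hA - hB + r 1 * σ (r 1) * h3K
  simp [hb] at this

theorem step [Fintype F] {n e : ℕ} (σ : K →ₐ[F] K) (hσ : ∀ x, σ x = x ^ e) (hσ2 : ∀ x, σ (σ x) = x)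
    (hqn : ¬(Fintype.card F = 2 ∧ n = 2))
    (C : Submodule K (Fin n → K)) (r : Fin n → K) (hr : r ∈ hull n e C) (hr0 : r ≠ 0) :
    ∃ M : Matrix (Fin n) (Fin n) F, IsUnit M ∧
    Module.finrank K (hull n e (C.map (rm M))) + 1 = Module.finrank K (hull n e C) := by
  obtain ⟨i, hi⟩ : ∃ i, r i ≠ 0 := by
    by_contra! h
    exact hr0 (funext h)
  by_cases hα : ∃ α : F, α ≠ 0 ∧ α ≠ 1 ∧ α ≠ -1
  · obtain ⟨α, h0, h1, h1'⟩ := hα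
    have hvv : (Pi.single i 1 : Fin n → F) ⬝ᵥ Pi.single i 1 = 1 := by simp
    have hR := rank1 (Pi.single i 1 : Fin n → F) (α - 1) (by rw [hvv]; simpa using h0)
    refine ⟨_, hR.1, key2 σ hσ hσ2 C _ hR.1 _ _ ?_ hR.2 r hr ?_⟩
    · rw [hvv]
      have : 2 * (α - 1) + (α - 1) ^ 2 * 1 = (α - 1) * (α + 1) := by ring
      rw [this]
      exact mul_ne_zero (sub_ne_zero.2 h1) (fun h => h1' (eq_neg_of_add_eq_zero_left h))
    · rw [Finset.sum_eq_single i]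
      · simpa using hi
      · intro b _ hb; simp [hb]
      · simp
  push Not at hα
  by_cases h2 : (2 : F) = 0
  · have hcard : Fintype.card F = 2 := by
      classical
      have : (Finset.univ : Finset F) = {0, 1} := by
        ext a
        simp only [Finset.mem_univ, Finset.mem_insert, Finset.mem_singleton, true_iff]
        by_contra! h
        exact h.2 ((hα a h.1 h.2).trans (by linear_combination -h2))
      rw [← Finset.card_univ, this]
      exact Finset.card_pair zero_ne_one
    have hn : n ≠ 2 := fun h => hqn ⟨hcard, h⟩
    by_cases hconst : ∀ j, r j = r i
    · apply puncture σ hσ hσ2 h2 C i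
      have : (fun _ => 1 : Fin n → K) = (r i)⁻¹ • r := by
        ext j; simp [hconst j, hi]
      rw [this]
      exact Submodule.smul_mem _ _ hr
    · push Not at hconst
      obtain ⟨j, hj⟩ := hconst
      have hij : i ≠ j := fun h => hj (by rw [h])
      obtain ⟨k, hk⟩ : ∃ k, k ∉ ({i, j} : Finset (Fin n)) := by
        by_contra! h
        have h1 : (Finset.univ : Finset (Fin n)) = {i, j} := by
          ext a; simpa using h a
        have := congrArg Finset.card h1
        rw [Finset.card_pair hij, Finset.card_univ, Fintype.card_fin] at this
        exact hn this
      simp only [Finset.mem_insert, Finset.mem_singleton, not_or] at hk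
      obtain ⟨M, hM, hMM⟩ := mat3 h2 i j k hij (Ne.symm hk.1) (Ne.symm hk.2)
      refine ⟨M, hM, key2 σ hσ hσ2 C M hM _ 1 one_ne_zero hMM r hr ?_⟩
      have h2K : (2 : K) = 0 := by
        have := congrArg (algebraMap F K) h2
        rwa [map_ofNat, map_zero] at this
      have : ∑ a, r a * algebraMap F K ((Pi.single i 1 + Pi.single j 1 : Fin n → F) a)
          = r i + r j := by
        simp [mul_add, Finset.sum_add_distrib, Pi.single_apply, apply_ite (algebraMap F K)]
      rw [this]
      intro h
      exact hj (by linear_combination h - r i * h2K)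
  · have h3 : (3 : F) = 0 := by
      have := hα 2 h2 (fun h => one_ne_zero (α := F) (by linear_combination h))
      linear_combination this
    have h3K : (3 : K) = 0 := by
      have := congrArg (algebraMap F K) h3
      rwa [map_ofNat, map_zero] at this
    by_cases hn : n = 2
    · subst hn
      exact two3 σ hσ hσ2 h3 C r hr hr0
    by_cases hn1 : n = 1
    · subst hn1
      exfalso
      have hr' := (mem_hull σ hσ C _).1 hr
      have := hr'.2 r hr'.1
      have hi0 : i = 0 := Subsingleton.elim _ _
      subst hi0
      simp [sB, dotProduct, hi] at this
    have hlt : 3 ≤ n := by have := i.2; omega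
    obtain ⟨j, hj⟩ : ∃ j, j ∉ ({i} : Finset (Fin n)) := by
      by_contra! h
      have h1 : (Finset.univ : Finset (Fin n)) = {i} := by
        ext a; simpa using h a
      have := congrArg Finset.card h1
      rw [Finset.card_singleton, Finset.card_univ, Fintype.card_fin] at this
      omega
    have hij : i ≠ j := fun h => hj (by simp [h])
    obtain ⟨k, hk⟩ : ∃ k, k ∉ ({i, j} : Finset (Fin n)) := by
      by_contra! h
      have h1 : (Finset.univ : Finset (Fin n)) = {i, j} := by
        ext a; simpa using h a
      have := congrArg Finset.card h1
      rw [Finset.card_pair hij, Finset.card_univ, Fintype.card_fin] at this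
      exact hn this
    simp only [Finset.mem_insert, Finset.mem_singleton, not_or] at hk
    obtain ⟨hki, hkj⟩ := hk
    have main : ∀ s t : F, s ^ 2 = 1 → t ^ 2 = 1 →
        r i + r j * algebraMap F K s + r k * algebraMap F K t ≠ 0 →
        ∃ M : Matrix (Fin n) (Fin n) F, IsUnit M ∧
        Module.finrank K (hull n e (C.map (rm M))) + 1 = Module.finrank K (hull n e C) := by
      intro s t hs ht hne
      let v : Fin n → F := Pi.single i 1 + Pi.single j s + Pi.single k t
      have hvv : v ⬝ᵥ v = 0 := by
        simp [v, add_dotProduct, Pi.single_apply, hij, hij.symm, hki, hkj, Ne.symm hki, Ne.symm hkj]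
        linear_combination hs + ht + h3
      have hR := rank1 v 1 (by rw [hvv]; simp)
      refine ⟨_, hR.1, key2 σ hσ hσ2 C _ hR.1 _ _ ?_ hR.2 r hr ?_⟩
      · rw [hvv]; simpa using h2
      · have : ∑ a, r a * algebraMap F K (v a)
            = r i + r j * algebraMap F K s + r k * algebraMap F K t := by
          simp [v, mul_add, Finset.sum_add_distrib, Pi.single_apply, apply_ite (algebraMap F K)]
        rw [this]
        exact hne
    by_contra hcon
    have h1 := not_imp_comm.1 (main 1 1 (by ring) (by ring)) hcon
    have h2 := not_imp_comm.1 (main 1 (-1) (by ring) (by ring)) hcon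
    have h3 := not_imp_comm.1 (main (-1) 1 (by ring) (by ring)) hcon
    have h4 := not_imp_comm.1 (main (-1) (-1) (by ring) (by ring)) hcon
    simp at h1 h2 h3 h4
    apply hi
    linear_combination h1 + h2 + h3 + h4 - r i * h3K

theorem iter [Fintype F] {n e : ℕ} (σ : K →ₐ[F] K) (hσ : ∀ x, σ x = x ^ e) (hσ2 : ∀ x, σ (σ x) = x)
    (hqn : ¬(Fintype.card F = 2 ∧ n = 2)) (C : Submodule K (Fin n → K)) (d l : ℕ)
    (hd : Module.finrank K (hull n e C) = l + d) :
    ∃ M : Matrix (Fin n) (Fin n) F, IsUnit M ∧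
    Module.finrank K (hull n e (C.map (rm M))) = l := by
  induction d generalizing C with
  | zero =>
    refine ⟨1, isUnit_one, ?_⟩
    have : rm (K := K) (1 : Matrix (Fin n) (Fin n) F) = LinearMap.id := by
      refine LinearMap.ext fun x => ?_
      simp [rm]
    rw [this, Submodule.map_id, hd, add_zero]
  | succ d ih =>
    have hne : hull n e C ≠ ⊥ := by
      intro h
      rw [h, finrank_bot] at hd
      omega
    obtain ⟨r, hr, hr0⟩ := Submodule.exists_mem_ne_zero_of_ne_bot hne
    obtain ⟨M, hM, hMr⟩ := step σ hσ hσ2 hqn C r hr hr0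
    obtain ⟨N, hN, hNr⟩ := ih (C.map (rm M)) (by omega)
    refine ⟨M * N, hM.mul hN, ?_⟩
    rw [← rm_mul]
    exact hNr

end

/-- Hermitian hull variation. If `(q,n) ≠ (2,2)` and `C ⊆ K^n` has Hermitian
hull dimension `h`, then every `ℓ ∈ {0,…,h}` is the Hermitian hull dimension of some
equivalent code `C·M`, `M ∈ GL_n(F_q)`. In particular (`ℓ = 0`) `C` is equivalent to a
Hermitian LCD code. -/
theorem stmt10 (m n h : ℕ) (hm : 1 ≤ m)
    (F : Type*) [Field F] [Fintype F]
    (K : Type*) [Field K] [Fintype K] [Algebra F K]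
    (hK : Fintype.card K = Fintype.card F ^ (2 * m))
    (hqn : ¬(Fintype.card F = 2 ∧ n = 2))
    (C : Submodule K (Fin n → K))
    (hh : Module.finrank K ↥(C ⊓ hermDual n (Fintype.card F ^ m) C) = h) :
    ∀ l : ℕ, l ≤ h →
      ∃ M : Matrix (Fin n) (Fin n) F, IsUnit M ∧
        Module.finrank K
          ↥((C.map (M.map (algebraMap F K)).vecMulLinear) ⊓
            hermDual n (Fintype.card F ^ m) (C.map (M.map (algebraMap F K)).vecMulLinear)) = l := by
  intro l hl
  have hσ : ∀ x, ((FiniteField.frobeniusAlgHom F K) ^ m) x = x ^ (Fintype.card F ^ m) := by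
    intro x
    rw [AlgHom.coe_pow, FiniteField.coe_frobeniusAlgHom, pow_iterate]
  refine iter ((FiniteField.frobeniusAlgHom F K) ^ m) hσ ?_ hqn C (h - l) l ?_
  · intro x
    rw [hσ, hσ, ← pow_mul, ← pow_add, ← two_mul, ← hK, FiniteField.pow_card]
  · rw [hull, hh]
    omega
end

section
/- For every prime power q and every m ≥ 1, there exists a Hermitian self-dual K-linear vector rank-metric code C ⊆ K^{2m} with K = F_{q^{2m}}, dim_K C = m, and minimum rank distance m+1 (i.e. a Hermitian self-dual MRD code with parameters [2m, m, m+1]_{q^{2m}/q}). -/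
open Module LinearMap in
lemma aux_perp {F V : Type*} [Field F] [AddCommGroup V] [Module F V] [FiniteDimensional F V]
    (B : LinearMap.BilinForm F V) (hs : ∀ x y, B x y = B y x) (hB : B.Nondegenerate)
    (v : V) (hv : B v v ≠ 0) (n : ℕ) (hn : finrank F V = n + 1) :
    (B.restrict (B.orthogonal (Submodule.span F {v}))).Nondegenerate ∧
    finrank F (B.orthogonal (Submodule.span F {v})) = n ∧
    (∀ x, x ∈ B.orthogonal (Submodule.span F {v}) ↔ B v x = 0) := by
  have hr : B.IsRefl := fun x y h => by rw [hs]; exact h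
  refine ⟨B.restrict_nondegenerate_orthogonal_spanSingleton hB hr hv, ?_, ?_⟩
  · have hv0 : v ≠ 0 := by rintro rfl; simp at hv
    rw [LinearMap.BilinForm.finrank_orthogonal hB, hn, finrank_span_singleton hv0]
    rfl
  · intro x
    rw [LinearMap.BilinForm.mem_orthogonal_iff]
    constructor
    · intro h; exact h v (Submodule.mem_span_singleton_self v)
    · intro h y hy
      obtain ⟨c, rfl⟩ := Submodule.mem_span_singleton.1 hy
      simp [h]

lemma aux_cons {F V : Type*} [Field F] [AddCommGroup V] [Module F V]
    (B : LinearMap.BilinForm F V) (hs : ∀ x y, B x y = B y x) (v : V) (n : ℕ)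
    (b : Fin n → V) (hvb : ∀ i, B v (b i) = 0) (w : Fin n → F)
    (hb : ∀ i j, B (b i) (b j) = if i = j then w i else 0) :
    ∀ i j, B ((Fin.cons v b : Fin (n+1) → V) i) ((Fin.cons v b : Fin (n+1) → V) j) =
      if i = j then (Fin.cons (B v v) w : Fin (n+1) → F) i else 0 := by
  intro i j
  refine Fin.cases ?_ (fun i => ?_) i <;> refine Fin.cases ?_ (fun j => ?_) j
  · simp
  · simp [hvb, (Fin.succ_ne_zero j).symm]
  · simp [hs _ v, hvb, Fin.succ_ne_zero]
  · simp [hb]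

lemma aux_exists_ne {F V : Type*} [Field F] [AddCommGroup V] [Module F V]
    (h2 : (2 : F) ≠ 0) (B : LinearMap.BilinForm F V) (hs : ∀ x y, B x y = B y x)
    (hB : B.Nondegenerate) (n : ℕ) (hn : Module.finrank F V = n + 1) : ∃ v, B v v ≠ 0 := by
  have := invertibleOfNonzero h2
  have : Nontrivial V := Module.nontrivial_of_finrank_pos (R := F) (by omega)
  obtain ⟨x, hx⟩ := exists_ne (0 : V)
  refine LinearMap.BilinForm.exists_bilinForm_self_ne_zero (B := B) ?_ ⟨fun x y => by simp [hs x y]⟩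
  rintro rfl
  exact hx (hB.1 x (by simp))

lemma aux_sq_sum {F : Type*} [Field F] [Fintype F] (h2 : (2 : F) ≠ 0) (a b : F) (ha : a ≠ 0)
    (hb : b ≠ 0) : ∃ s t : F, a * s ^ 2 + b * t ^ 2 = 1 := by
  have hodd : Fintype.card F % 2 = 1 := by
    apply FiniteField.odd_card_of_char_ne_two
    intro h
    have : CharP F 2 := ringChar.of_eq h
    exact h2 (by exact_mod_cast CharP.cast_eq_zero F 2)
  obtain ⟨s, t, h⟩ := FiniteField.exists_root_sum_quadratic (R := F)
    (f := Polynomial.C a * Polynomial.X ^ 2 + Polynomial.C 0 * Polynomial.X + Polynomial.C 0)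
    (g := Polynomial.C b * Polynomial.X ^ 2 + Polynomial.C 0 * Polynomial.X + Polynomial.C (-1))
    (Polynomial.degree_quadratic ha) (Polynomial.degree_quadratic hb) hodd
  refine ⟨s, t, ?_⟩
  simp at h
  linear_combination h

lemma aux_odd {F : Type*} [Field F] [Fintype F] (h2 : (2 : F) ≠ 0) (n : ℕ) :
    ∀ {V : Type*} [AddCommGroup V] [Module F V] [FiniteDimensional F V]
    (B : LinearMap.BilinForm F V), (∀ x y, B x y = B y x) → B.Nondegenerate →
    Module.finrank F V = n + 1 → ∃ (b : Fin (n+1) → V) (d : F), d ≠ 0 ∧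
      ∀ i j, B (b i) (b j) = if i = j then (if i = Fin.last n then d else 1) else 0 := by
  induction n with
  | zero =>
    intro V _ _ _ B hs hB hn
    obtain ⟨v, hv⟩ := aux_exists_ne h2 B hs hB 0 hn
    refine ⟨fun _ => v, B v v, hv, fun i j => ?_⟩
    have hi : i = Fin.last 0 := Fin.ext (by omega)
    have hj : j = Fin.last 0 := Fin.ext (by omega)
    rw [hi, hj]; simp
  | succ n ih =>
    intro V _ _ _ B hs hB hn
    obtain ⟨x, hx⟩ := aux_exists_ne h2 B hs hB _ hn
    obtain ⟨h1, h3, h4⟩ := aux_perp B hs hB x hx _ hn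
    obtain ⟨⟨y, hy'⟩, hy⟩ := aux_exists_ne h2 (B.restrict (B.orthogonal (Submodule.span F {x})))
      (fun x y => hs x y) h1 _ h3
    change B y y ≠ 0 at hy
    rw [h4] at hy'
    obtain ⟨s, t, hst⟩ := aux_sq_sum h2 _ _ hx hy
    have hv : B (s • x + t • y) (s • x + t • y) = 1 := by
      simp [hy', hs y x]
      linear_combination hst
    generalize s • x + t • y = v at hv
    obtain ⟨h1, h3, h4⟩ := aux_perp B hs hB v (by simp [hv]) _ hn
    obtain ⟨b, d, hd, hb⟩ := ih (B.restrict (B.orthogonal (Submodule.span F {v})))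
      (fun x y => hs x y) h1 h3
    refine ⟨Fin.cons v (fun i => (b i : V)), d, hd, fun i j => ?_⟩
    rw [aux_cons B hs v _ (fun i => (b i : V)) (fun i => (h4 _).1 (b i).2) _ hb i j]
    congr 1
    refine Fin.cases ?_ (fun i => ?_) i
    · simp [hv, Fin.ext_iff]
    · simp [Fin.ext_iff]

lemma aux_even {F : Type*} [Field F] [Fintype F] (h2 : (2 : F) = 0) (n : ℕ) :
    ∀ {V : Type*} [AddCommGroup V] [Module F V] [FiniteDimensional F V]
    (B : LinearMap.BilinForm F V), (∀ x y, B x y = B y x) → B.Nondegenerate →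
    (n ≠ 0 → ∃ v, B v v ≠ 0) →
    Module.finrank F V = n → ∃ (b : Fin n → V),
      ∀ i j, B (b i) (b j) = if i = j then 1 else 0 := by
  have hc : ringChar F = 2 := by
    have : CharP F 2 := CharTwo.of_one_ne_zero_of_two_eq_zero one_ne_zero h2
    exact ringChar.eq F 2
  induction n with
  | zero => exact fun {V} _ _ _ B _ _ _ _ => ⟨Fin.elim0, fun i => i.elim0⟩
  | succ n ih =>
    intro V _ _ _ B hs hB hna hn
    obtain ⟨x, hx⟩ := hna (by simp)
    obtain ⟨s, hsq⟩ := FiniteField.isSquare_of_char_two hc (B x x)⁻¹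
    have hx1 : B (s • x) (s • x) = 1 := by
      simp only [map_smul, LinearMap.smul_apply, smul_eq_mul]
      rw [← mul_assoc, ← hsq, inv_mul_cancel₀ hx]
    generalize s • x = u at hx1
    have key : ∃ v, B v v = 1 ∧ (n ≠ 0 → ∃ z, B v z = 0 ∧ B z z ≠ 0) := by
      by_cases hu : n ≠ 0 → ∃ z, B u z = 0 ∧ B z z ≠ 0
      · exact ⟨u, hx1, hu⟩
      · push Not at hu
        obtain ⟨hn0, hu⟩ := hu
        obtain ⟨h1, h3, h4⟩ := aux_perp B hs hB u (by simp [hx1]) _ hn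
        have : Nontrivial (B.orthogonal (Submodule.span F {u})) :=
          Module.nontrivial_of_finrank_pos (R := F) (by omega)
        obtain ⟨x, hx⟩ := exists_ne (0 : B.orthogonal (Submodule.span F {u}))
        have : ∃ y, B.restrict _ x y ≠ 0 := by
          by_contra! h
          exact hx (h1.1 x h)
        obtain ⟨y, hy⟩ := this
        change B x y ≠ 0 at hy
        have hux := (h4 _).1 x.2
        have huy := (h4 _).1 y.2
        refine ⟨u + (x : V), ?_, fun _ => ⟨u + (-(B x y)⁻¹) • (y : V), ?_, ?_⟩⟩
        · simp [hx1, hux, hs _ u, hu _ hux]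
        · simp [hx1, hux, hs _ u, huy]
          field_simp
          simp
        · simp [hx1, huy, hs _ u, hu _ huy]
    obtain ⟨v, hv, hz⟩ := key
    obtain ⟨h1, h3, h4⟩ := aux_perp B hs hB v (by simp [hv]) _ hn
    obtain ⟨b, hb⟩ := ih (B.restrict (B.orthogonal (Submodule.span F {v})))
      (fun x y => hs x y) h1 (fun h => by
      obtain ⟨z, hz1, hz2⟩ := hz h
      exact ⟨⟨z, (h4 z).2 hz1⟩, hz2⟩) h3
    refine ⟨Fin.cons v (fun i => (b i : V)), fun i j => ?_⟩
    rw [aux_cons B hs v _ (fun i => (b i : V)) (fun i => (h4 _).1 (b i).2) (fun _ => 1) hb i j]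
    congr 1
    refine Fin.cases ?_ (fun i => ?_) i
    · simp [hv]
    · simp

/-- Existence of scaled trace-self-dual bases. -/
lemma aux_trace {F K : Type*} [Field F] [Fintype F] [Field K] [Fintype K] [Algebra F K]
    (n : ℕ) (hn : Module.finrank F K = n + 1) :
    ∃ (b : Fin (n+1) → K) (l : K),
      ∀ i j, Algebra.trace F K (l * (b i * b j)) = if i = j then 1 else 0 := by
  classical
  have hT := traceForm_nondegenerate F K
  by_cases h2 : (2 : F) = 0
  · obtain ⟨b, hb⟩ := aux_even h2 (n+1) (Algebra.traceForm F K)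
      (fun x y => by simp [Algebra.traceForm_apply, mul_comm]) hT (fun _ => by
        by_contra! h
        obtain ⟨x, hx⟩ := Algebra.trace_surjective F K 1
        have hz : ∀ y : K, Algebra.trace F K y = 0 := by
          intro y
          have : CharP F 2 := CharTwo.of_one_ne_zero_of_two_eq_zero one_ne_zero h2
          have : CharP K 2 := charP_of_injective_algebraMap (algebraMap F K).injective 2
          obtain ⟨z, hz⟩ := FiniteField.isSquare_of_char_two (ringChar.eq K 2) y
          rw [hz]; exact h z
        exact one_ne_zero (hx.symm.trans (hz x))) hn
    exact ⟨b, 1, fun i j => by rw [one_mul]; exact hb i j⟩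
  · let e := Module.finBasisOfFinrankEq F K hn
    set G := LinearMap.BilinForm.toMatrix e (Algebra.traceForm F K) with hG
    have hdet : G.det ≠ 0 := (LinearMap.BilinForm.nondegenerate_iff_det_ne_zero e).1 hT
    obtain ⟨l, hl⟩ := FiniteField.norm_surjective F K G.det
    let B := (Algebra.traceForm F K).compLeft (Algebra.lmul F K l)
    have hBa : ∀ x y, B x y = Algebra.trace F K (l * (x * y)) := by
      intro x y
      simp [B, Algebra.traceForm_apply, mul_assoc]
    have hBd : (LinearMap.BilinForm.toMatrix e B).det = G.det ^ 2 := by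
      rw [LinearMap.BilinForm.toMatrix_compLeft, Matrix.det_mul, Matrix.det_transpose,
        LinearMap.det_toMatrix, ← Algebra.norm_apply, hl, ← hG, sq]
    have hBn : B.Nondegenerate := by
      rw [LinearMap.BilinForm.nondegenerate_iff_det_ne_zero e, hBd]
      exact pow_ne_zero _ hdet
    obtain ⟨b, d, hd, hb⟩ := aux_odd h2 n B (fun x y => by rw [hBa, hBa, mul_comm x y]) hBn hn
    have hds : IsSquare d := by
      have hm : (e.toMatrix b).transpose * LinearMap.BilinForm.toMatrix e B * e.toMatrix b
          = Matrix.diagonal (fun i => if i = Fin.last n then d else 1) := by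
        ext i j
        rw [Matrix.diagonal_apply, ← hb i j]
        conv_rhs => rw [← e.sum_repr (b i), ← e.sum_repr (b j)]
        simp [Matrix.mul_apply, Module.Basis.toMatrix_apply, Finset.sum_mul, Finset.mul_sum,
          LinearMap.BilinForm.toMatrix_apply, -Module.Basis.sum_repr]
        try (refine Finset.sum_congr rfl fun _ _ => Finset.sum_congr rfl fun _ _ => by ring)
      have := congrArg Matrix.det hm
      rw [Matrix.det_mul, Matrix.det_mul, Matrix.det_transpose, hBd, Matrix.det_diagonal] at this
      simp at this
      exact ⟨(e.toMatrix b).det * G.det, by rw [← this]; ring⟩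
    obtain ⟨s, rfl⟩ := hds
    have hs0 : s ≠ 0 := by rintro rfl; simp at hd
    refine ⟨fun i => (if i = Fin.last n then s⁻¹ else 1) • b i, l, fun i j => ?_⟩
    rw [← hBa]
    simp only [map_smul, LinearMap.smul_apply, hb, smul_eq_mul]
    by_cases hij : i = j
    · subst hij
      by_cases hi : i = Fin.last n
      · simp [hi]; field_simp
      · simp [hi]
    · simp [hij]

lemma aux_trace' {F K : Type*} [Field F] [Fintype F] [Field K] [Fintype K] [Algebra F K]
    (N : ℕ) (hN : N ≠ 0) (hn : Module.finrank F K = N) :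
    ∃ (b : Fin N → K) (l : K),
      ∀ i j, Algebra.trace F K (l * (b i * b j)) = if i = j then 1 else 0 := by
  cases N with
  | zero => exact absurd rfl hN
  | succ n => exact aux_trace n hn

lemma aux_frob {F K : Type*} [Field F] [Fintype F] [Field K] [Algebra F K] (k : ℕ) :
    ∃ φ : K →ₐ[F] K, ∀ x, φ x = x ^ (Fintype.card F ^ k) := by
  induction k with
  | zero => exact ⟨AlgHom.id F K, fun x => by simp⟩
  | succ k ih =>
    obtain ⟨φ, hφ⟩ := ih
    refine ⟨(FiniteField.frobeniusAlgHom F K).comp φ, fun x => ?_⟩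
    simp [hφ, pow_succ, pow_mul]

lemma aux_indep {F K : Type*} [Field F] [Field K] [Algebra F K]
    (N : ℕ) (b : Fin N → K) (l : K)
    (hb : ∀ i j, Algebra.trace F K (l * (b i * b j)) = if i = j then 1 else 0) :
    LinearIndependent F b := by
  rw [Fintype.linearIndependent_iff]
  intro g hg i
  have h : Algebra.trace F K (l * (b i * ∑ j, g j • b j)) = g i := by
    simp only [Finset.mul_sum, map_sum, mul_smul_comm, map_smul, hb]
    simp
  rw [hg] at h
  simpa using h.symm

lemma aux_gram {F K : Type*} [Field F] [Fintype F] [Field K] [Fintype K] [Algebra F K]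
    (N : ℕ) (hn : Module.finrank F K = N) (b : Fin N → K) (l : K)
    (hb : ∀ i j, Algebra.trace F K (l * (b i * b j)) = if i = j then 1 else 0) :
    (∀ j k : Fin N, ∑ i : Fin N, b j ^ (Fintype.card F ^ (i : ℕ)) *
      (l ^ (Fintype.card F ^ (i : ℕ)) * b k ^ (Fintype.card F ^ (i : ℕ))) =
        if j = k then 1 else 0) ∧
    (∀ i k : Fin N, ∑ j : Fin N, (l ^ (Fintype.card F ^ (i : ℕ)) *
      b j ^ (Fintype.card F ^ (i : ℕ))) * b j ^ (Fintype.card F ^ (k : ℕ)) =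
        if i = k then 1 else 0) := by
  classical
  have h1 : ∀ j k : Fin N, ∑ i : Fin N, b j ^ (Fintype.card F ^ (i : ℕ)) *
      (l ^ (Fintype.card F ^ (i : ℕ)) * b k ^ (Fintype.card F ^ (i : ℕ))) =
        if j = k then 1 else 0 := by
    intro j k
    have h := FiniteField.algebraMap_trace_eq_sum_pow F K (l * (b j * b k))
    rw [hb, hn, Finset.sum_range, Nat.card_eq_fintype_card] at h
    have h' : algebraMap F K (if j = k then 1 else 0) = if j = k then 1 else 0 := by
      split_ifs <;> simp
    rw [← h', h]
    refine Finset.sum_congr rfl fun i _ => ?_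
    rw [mul_pow, mul_pow]; ring
  refine ⟨h1, ?_⟩
  let A : Matrix (Fin N) (Fin N) K := Matrix.of fun i j => b j ^ (Fintype.card F ^ (i : ℕ))
  let D : Matrix (Fin N) (Fin N) K := Matrix.of fun i j =>
    l ^ (Fintype.card F ^ (i : ℕ)) * b j ^ (Fintype.card F ^ (i : ℕ))
  have h2 : A.transpose * D = 1 := by
    ext j k
    rw [Matrix.one_apply, ← h1 j k]
    simp [Matrix.mul_apply, A, D]
  rw [mul_eq_one_comm] at h2
  intro i k
  have h3 := congrFun (congrFun h2 i) k
  rw [Matrix.one_apply] at h3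
  rw [← h3]
  simp [Matrix.mul_apply, A, D]

/-- A nonzero `q`-polynomial of `q`-degree less than `m` has a kernel of dimension less than `m`. -/
lemma aux_ker {F K : Type*} [Field F] [Fintype F] [Field K] [Fintype K] [Algebra F K]
    (m : ℕ) (hm : 1 ≤ m) (a : Fin m → K) (ha : a ≠ 0) (f : K →ₗ[F] K)
    (hf : ∀ x, f x = ∑ i : Fin m, a i * x ^ (Fintype.card F ^ (i : ℕ))) :
    Module.finrank F (LinearMap.ker f) ≤ m - 1 := by
  classical
  have hq : 1 < Fintype.card F := Fintype.one_lt_card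
  let P : Polynomial K := ∑ i : Fin m,
    Polynomial.C (a i) * Polynomial.X ^ (Fintype.card F ^ (i : ℕ))
  have hP : P ≠ 0 := by
    intro h
    apply ha
    funext k
    have hc : P.coeff (Fintype.card F ^ (k : ℕ)) = a k := by
      simp only [P, Polynomial.finsetSum_coeff, Polynomial.coeff_C_mul, Polynomial.coeff_X_pow]
      rw [Finset.sum_eq_single k]
      · simp
      · intro j _ hj
        rw [if_neg, mul_zero]
        intro h
        exact hj (Fin.ext (Nat.pow_right_injective hq h).symm)
      · simp
    rw [← hc, h]; simp
  have hdeg : P.natDegree ≤ Fintype.card F ^ (m - 1) := by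
    apply Polynomial.natDegree_sum_le_of_forall_le
    intro i _
    refine (Polynomial.natDegree_C_mul_X_pow_le _ _).trans ?_
    exact Nat.pow_le_pow_right hq.le (by omega)
  have hcard : Fintype.card (LinearMap.ker f) ≤ Fintype.card F ^ (m - 1) := by
    calc Fintype.card (LinearMap.ker f)
        = (Finset.univ.filter (fun x => x ∈ LinearMap.ker f)).card := Fintype.card_subtype _
      _ ≤ P.roots.toFinset.card := by
          apply Finset.card_le_card
          intro x hx
          have hx' : f x = 0 := by simpa using hx
          rw [Multiset.mem_toFinset, Polynomial.mem_roots hP, Polynomial.IsRoot]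
          rw [hf] at hx'
          simpa [P, Polynomial.eval_finsetSum] using hx'
      _ ≤ P.roots.card := Multiset.toFinset_card_le _
      _ ≤ P.natDegree := Polynomial.card_roots' P
      _ ≤ _ := hdeg
  rw [Module.card_eq_pow_finrank (K := F)] at hcard
  exact (Nat.pow_le_pow_iff_right hq).1 hcard

/-- for every prime power `q` and `m ≥ 1`, there is a Hermitian self-dual MRD
code `C ⊆ K^{2m}` over `K = F_{q^{2m}}` with `dim_K C = m` and minimum rank distance `m+1`. -/
theorem stmt17 (m : ℕ) (hm : 1 ≤ m)
    (F : Type*) [Field F] [Fintype F]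
    (K : Type*) [Field K] [Fintype K] [Algebra F K]
    (hK : Fintype.card K = Fintype.card F ^ (2 * m)) :
    ∃ C : Submodule K (Fin (2 * m) → K),
      Module.finrank K C = m ∧
      C = hermDual (2 * m) (Fintype.card F ^ m) C ∧
      (∀ c ∈ C, c ≠ 0 →
        m + 1 ≤ Module.finrank F (Submodule.span F (Set.range c))) ∧
      (∃ c ∈ C, c ≠ 0 ∧
        Module.finrank F (Submodule.span F (Set.range c)) = m + 1) := by
  classical
  have hq : 1 < Fintype.card F := Fintype.one_lt_card
  have hn : Module.finrank F K = 2 * m := by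
    rw [Module.card_eq_pow_finrank (K := F)] at hK
    exact Nat.pow_right_injective hq hK
  obtain ⟨b, l, hb⟩ := aux_trace' (F := F) (K := K) (2 * m) (by omega) hn
  obtain ⟨g1, g2⟩ := aux_gram (2 * m) hn b l hb
  have hli := aux_indep (2 * m) b l hb
  have hspan : Submodule.span F (Set.range b) = ⊤ :=
    hli.span_eq_top_of_card_eq_finrank' (by simp [hn])
  have hl : l ≠ 0 := by
    rintro rfl
    have := hb ⟨0, by omega⟩ ⟨0, by omega⟩
    simp at this
  choose φ hφ using aux_frob (F := F) (K := K)
  -- the encoding map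
  let Φ : (Fin m → K) →ₗ[K] (Fin (2 * m) → K) :=
    { toFun := fun a j => ∑ i : Fin m, a i * b j ^ (Fintype.card F ^ (i : ℕ))
      map_add' := fun x y => by
        funext j; simp [add_mul, Finset.sum_add_distrib]
      map_smul' := fun c x => by
        funext j; simp [Finset.mul_sum, mul_assoc] }
  have hΦ : ∀ a j, Φ a j = ∑ i : Fin m, a i * b j ^ (Fintype.card F ^ (i : ℕ)) :=
    fun _ _ => rfl
  have hX : ∀ (a : Fin m → K) (k : Fin (2 * m)),
      ∑ j, (l ^ (Fintype.card F ^ (k : ℕ)) * b j ^ (Fintype.card F ^ (k : ℕ))) * Φ a j =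
        if h : (k : ℕ) < m then a ⟨k, h⟩ else 0 := by
    intro a k
    have e1 : ∀ i : Fin m, ∑ j, (l ^ (Fintype.card F ^ (k : ℕ)) *
        b j ^ (Fintype.card F ^ (k : ℕ))) * b j ^ (Fintype.card F ^ (i : ℕ)) =
        if (k : ℕ) = i then 1 else 0 := by
      intro i
      have := g2 k ⟨i, by omega⟩
      simpa [Fin.ext_iff] using this
    simp only [hΦ, Finset.mul_sum]
    rw [Finset.sum_comm]
    have e2 : ∀ i : Fin m, ∑ j, (l ^ (Fintype.card F ^ (k : ℕ)) *
        b j ^ (Fintype.card F ^ (k : ℕ))) * (a i * b j ^ (Fintype.card F ^ (i : ℕ))) =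
        if (k : ℕ) = i then a i else 0 := by
      intro i
      have : (if (k : ℕ) = i then a i else 0) = a i * (if (k : ℕ) = i then 1 else 0) := by simp
      rw [this, ← e1 i, Finset.mul_sum]
      exact Finset.sum_congr rfl fun j _ => by ring
    rw [Finset.sum_congr rfl fun i _ => e2 i]
    split_ifs with h
    · rw [Finset.sum_eq_single ⟨k, h⟩]
      · simp
      · intro i _ hi
        rw [if_neg]
        intro h'
        exact hi (Fin.ext h'.symm)
      · simp
    · refine Finset.sum_eq_zero fun i _ => ?_
      rw [if_neg]; omega
  have hinj : Function.Injective Φ := by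
    rw [← LinearMap.ker_eq_bot, LinearMap.ker_eq_bot']
    intro a ha
    funext i
    have := hX a ⟨i, by omega⟩
    rw [ha] at this
    simpa using this.symm
  have hmem : ∀ (C : Submodule K (Fin (2 * m) → K)) (x), x ∈ hermDual (2 * m) (Fintype.card F ^ m) C ↔
      ∀ c ∈ C, ∑ j, c j ^ (Fintype.card F ^ m) * x j = 0 := by
    intro C x
    simp [hermDual, Submodule.mem_iInf, LinearMap.sum_apply]
  have hshift : ∀ (a : Fin m → K) (x : Fin (2 * m) → K),
      ∑ j, (Φ a j) ^ (Fintype.card F ^ m) * x j =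
      ∑ i : Fin m, a i ^ (Fintype.card F ^ m) *
        ∑ j, b j ^ (Fintype.card F ^ ((i : ℕ) + m)) * x j := by
    intro a x
    simp only [Finset.mul_sum]
    rw [Finset.sum_comm]
    refine Finset.sum_congr rfl fun j _ => ?_
    rw [← hφ, hΦ, map_sum, Finset.sum_mul]
    refine Finset.sum_congr rfl fun i _ => ?_
    rw [hφ, mul_pow, pow_add, pow_mul, mul_assoc]
  have hrank : ∀ c ∈ LinearMap.range Φ, c ≠ 0 →
        m + 1 ≤ Module.finrank F (Submodule.span F (Set.range c)) := by
    rintro _ ⟨a, rfl⟩ hc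
    have ha : a ≠ 0 := by rintro rfl; simp at hc
    let f : K →ₗ[F] K := ∑ i : Fin m, (LinearMap.mulLeft F (a i)).comp (φ i).toLinearMap
    have hf : ∀ x, f x = ∑ i : Fin m, a i * x ^ (Fintype.card F ^ (i : ℕ)) := by
      intro x; simp [f, LinearMap.sum_apply, hφ]
    have hk := aux_ker m hm a ha f hf
    have hr : Submodule.span F (Set.range (Φ a)) = LinearMap.range f := by
      have : (Φ a : Fin (2 * m) → K) = f ∘ b := by
        funext j; simp [hf, hΦ]
      rw [this, Set.range_comp, ← Submodule.map_span, hspan, Submodule.map_top]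
    rw [hr]
    have := f.finrank_range_add_finrank_ker
    omega
  refine ⟨LinearMap.range Φ, ?_, ?_, hrank, ?_⟩
  · rw [LinearMap.finrank_range_of_inj hinj]; simp
  · ext x
    rw [hmem]
    constructor
    · rintro ⟨y, rfl⟩ _ ⟨a, rfl⟩
      rw [hshift]
      refine Finset.sum_eq_zero fun i _ => ?_
      have := hX y ⟨i + m, by omega⟩
      simp only [mul_assoc, ← Finset.mul_sum] at this
      rw [dif_neg (by omega)] at this
      rw [(mul_eq_zero.1 this).resolve_left (pow_ne_zero _ hl), mul_zero]
    · intro h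
      have h0 : ∀ i : Fin m, ∑ j, b j ^ (Fintype.card F ^ ((i : ℕ) + m)) * x j = 0 := by
        intro i
        have := h _ ⟨Pi.single i 1, rfl⟩
        rw [hshift, Finset.sum_eq_single i] at this
        · simpa using this
        · intro k _ hk
          have hc : Fintype.card F ^ m ≠ 0 := by positivity
          simp [hk]
        · simp
      let y : ℕ → K := fun k => l ^ (Fintype.card F ^ k) *
        ∑ j, b j ^ (Fintype.card F ^ k) * x j
      refine ⟨fun i => y i, ?_⟩
      funext j
      rw [hΦ]
      have hx : x j = ∑ k : Fin (2 * m), y k * b j ^ (Fintype.card F ^ (k : ℕ)) := by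
        have : x j = ∑ j', (if j = j' then 1 else 0) * x j' := by simp
        rw [this]
        simp only [← g1, y, Finset.sum_mul, Finset.mul_sum]
        rw [Finset.sum_comm]
        exact Finset.sum_congr rfl fun k _ => Finset.sum_congr rfl fun j' _ => by ring
      rw [hx, ← Finset.sum_range (fun k => y k * b j ^ (Fintype.card F ^ k)),
        ← Finset.sum_range (fun k => y k * b j ^ (Fintype.card F ^ k))]
      apply Finset.sum_subset
      · intro k; simp; omega
      · intro k hk hk'
        simp at hk hk'
        have := h0 ⟨k - m, by omega⟩
        simp only [Nat.sub_add_cancel hk'] at this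
        simp [y, this]
  · -- a nonzero codeword vanishing on the first `m - 1` coordinates
    let Ψ : (Fin m → K) →ₗ[K] (Fin (m - 1) → K) :=
      (LinearMap.funLeft K K (fun i : Fin (m - 1) => (⟨i, by omega⟩ : Fin (2 * m)))).comp Φ
    have hker : LinearMap.ker Ψ ≠ ⊥ := by
      apply LinearMap.ker_ne_bot_of_finrank_lt
      simp; omega
    obtain ⟨a, ha, ha0⟩ := Submodule.exists_mem_ne_zero_of_ne_bot hker
    have hc0 : Φ a ≠ 0 := fun h => ha0 (hinj (by rw [h, map_zero]))
    refine ⟨Φ a, ⟨a, rfl⟩, hc0, le_antisymm ?_ (hrank _ ⟨a, rfl⟩ hc0)⟩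
    have hz : ∀ j : Fin (2 * m), (j : ℕ) < m - 1 → Φ a j = 0 := by
      intro j hj
      exact congrFun (LinearMap.mem_ker.1 ha) ⟨j, hj⟩
    let c' : Fin (m + 1) → K := fun i => Φ a ⟨i + (m - 1), by omega⟩
    have hle : Submodule.span F (Set.range (Φ a)) ≤ Submodule.span F (Set.range c') := by
      rw [Submodule.span_le]
      rintro _ ⟨j, rfl⟩
      by_cases hj : (j : ℕ) < m - 1
      · rw [hz j hj]; exact Submodule.zero_mem _
      · apply Submodule.subset_span
        refine ⟨⟨j - (m - 1), by omega⟩, ?_⟩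
        have e : (⟨(j : ℕ) - (m - 1) + (m - 1), by omega⟩ : Fin (2 * m)) = j :=
          Fin.ext (Nat.sub_add_cancel (not_lt.1 hj))
        exact congrArg (Φ a) e
    calc _ ≤ Module.finrank F (Submodule.span F (Set.range c')) :=
          Submodule.finrank_mono hle
      _ ≤ Fintype.card (Fin (m + 1)) := finrank_range_le_card c'
      _ = m + 1 := by simp
end
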